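/- Under the NOD setup (see context), for every integer k ≥ 2, the Lyapunov function satisfies the contraction Ψ_{k+1} ≤ (1 − √(ημ)) · Ψ_k. -/

import Mathlib

open scoped RealInnerProductSpace

section helpers
variable {E : Type*} [NormedAddCommGroup E] [InnerProductSpace ℝ E]

lemma nod_descent [CompleteSpace E] (φ : E → ℝ) (L : ℝ)
    (hd : Differentiable ℝ φ)
    (hs : ∀ u v : E, ‖gradient φ u - gradient φ v‖ ≤ L * ‖u - v‖) (v e : E) :
    φ (v + e) ≤ φ v + ⟪gradient φ v, e⟫ + L / 2 * ‖e‖ ^ 2 := by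
  let h : ℝ → ℝ := fun t => φ (v + t • e) - t * ⟪gradient φ v, e⟫ - L / 2 * t ^ 2 * ‖e‖ ^ 2
  have hder : ∀ t : ℝ, HasDerivAt h
      (⟪gradient φ (v + t • e), e⟫ - ⟪gradient φ v, e⟫ - L * t * ‖e‖ ^ 2) t := by
    intro t
    have h1 : HasDerivAt (fun t : ℝ => v + t • e) e t := by
      simpa using ((hasDerivAt_id t).smul_const e).const_add v
    have h2 := ((hd (v + t • e)).hasGradientAt).hasFDerivAt.comp_hasDerivAt t h1
    have h3 := (hasDerivAt_id t).mul_const ⟪gradient φ v, e⟫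
    have h4 := (((hasDerivAt_id t).pow 2).const_mul (L / 2)).mul_const (‖e‖ ^ 2)
    have h5 := (h2.sub h3).sub h4
    refine h5.congr_deriv ?_
    rw [InnerProductSpace.toDual_apply_apply]
    simp only [id, Nat.cast_ofNat, one_mul, mul_one]
    simp only [show (2:ℕ) - 1 = 1 from rfl, pow_one]
    ring
  have hanti : AntitoneOn h (Set.Icc 0 1) := by
    apply antitoneOn_of_deriv_nonpos (convex_Icc 0 1)
    · exact fun t _ => (hder t).continuousAt.continuousWithinAt
    · exact fun t _ => (hder t).differentiableAt.differentiableWithinAt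
    · intro t ht
      rw [interior_Icc] at ht
      rw [(hder t).deriv, ← inner_sub_left]
      have h1 := real_inner_le_norm (gradient φ (v + t • e) - gradient φ v) e
      have h2 := hs (v + t • e) v
      have h3 : ‖v + t • e - v‖ = t * ‖e‖ := by
        rw [add_sub_cancel_left, norm_smul, Real.norm_of_nonneg ht.1.le]
      rw [h3] at h2
      nlinarith [norm_nonneg e, mul_le_mul_of_nonneg_right h2 (norm_nonneg e)]
  have := hanti (Set.left_mem_Icc.2 zero_le_one) (Set.right_mem_Icc.2 zero_le_one) zero_le_one
  simp only [h, one_smul, zero_smul, add_zero, one_pow, one_mul, mul_one, zero_mul, sub_zero,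
    mul_zero, ne_eq, OfNat.ofNat_ne_zero, not_false_eq_true, zero_pow] at this
  linarith

lemma nod_cocoercive [CompleteSpace E] (φ : E → ℝ) (L μ : ℝ) (hL : 0 < L) (hμ : 0 < μ)
    (hd : Differentiable ℝ φ)
    (hsc : ∀ u v : E, φ v ≥ φ u + ⟪gradient φ u, v - u⟫ + μ / 2 * ‖v - u‖ ^ 2)
    (hs : ∀ u v : E, ‖gradient φ u - gradient φ v‖ ≤ L * ‖u - v‖) (u v : E) :
    φ u + ⟪gradient φ u, v - u⟫ + 1 / (2 * L) * ‖gradient φ u - gradient φ v‖ ^ 2 ≤ φ v := by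
  set D := gradient φ u - gradient φ v with hD
  have h1 := nod_descent φ L hd hs v ((1 / L) • D)
  have h2 := hsc u (v + (1 / L) • D)
  have h3 : v + (1 / L) • D - u = (v - u) + (1 / L) • D := by abel
  have h4 : 0 ≤ μ / 2 * ‖v + (1 / L) • D - u‖ ^ 2 := by positivity
  have h5 : ⟪gradient φ u, D⟫ - ⟪gradient φ v, D⟫ = ‖D‖ ^ 2 := by
    rw [← inner_sub_left, ← hD, real_inner_self_eq_norm_sq]
  rw [norm_smul, Real.norm_of_nonneg (by positivity : (0 : ℝ) ≤ 1 / L), inner_smul_right] at h1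
  rw [h3] at h2 h4
  rw [inner_add_right, inner_smul_right] at h2
  have h6 : L / 2 * (1 / L * ‖D‖) ^ 2 = 1 / (2 * L) * ‖D‖ ^ 2 := by field_simp
  have h7 : 1 / L * ⟪gradient φ u, D⟫ - 1 / L * ⟪gradient φ v, D⟫
      = 2 * (1 / (2 * L) * ‖D‖ ^ 2) := by
    rw [← mul_sub, h5]; field_simp
  linarith

lemma nod_ident (μ η s : ℝ) (hη : 0 < η) (hs : 0 < s) (hμ : μ = s ^ 2 / η)
    (x p q G H : E) :
    μ * ‖(1 - s) • (x + (1 / s) • p) + s • x - (η / s) • (G + H)‖ ^ 2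
    = (1 - s) * (μ * ‖x + (1 / s) • p‖ ^ 2) + s * μ * ‖x‖ ^ 2 - μ * (1 - s) / s * ‖p‖ ^ 2
      - 2 * s * ⟪H, x + ((1 - s) / s) • p - (η * (1 - s) / s) • q⟫ - 2 * s * ⟪G, x⟫
      - 2 * (1 - s) * ⟪G, p - η • q⟫ - 2 * η * (1 - s) * ⟪G + H, q⟫ + η * ‖G + H‖ ^ 2 := by
  subst hμ
  simp only [← real_inner_self_eq_norm_sq, inner_add_left, inner_add_right, inner_sub_left,
    inner_sub_right, inner_smul_left, inner_smul_right, RCLike.conj_to_real]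
  rw [real_inner_comm x p, real_inner_comm x G, real_inner_comm x H, real_inner_comm p G,
    real_inner_comm p H, real_inner_comm G H]
  field_simp
  ring

set_option maxHeartbeats 2000000 in
lemma nod_scalar (c C B η L s LS P g1 g2 N Q : ℝ) (hc : 0 < c) (hC : C = c ^ 2) (hC1 : C < 1)
    (hceq : 1 - C - c * (C + 6) = 0) (hB : B = c / (1 - C)) (hη : 0 < η) (hL : 0 < L)
    (hs : 0 < s) (hsc : s ≤ c) (hηL : η * L ≤ C) (hLS : η * LS ≤ c * s) (hLS0 : 0 < LS)
    (hP : 0 ≤ P) (hg1 : 0 ≤ g1) (hg2 : 0 ≤ g2)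
    (hN : N ≤ (1 - s) / (1 + s) * P + 2 * η / (s * (1 + s)) * g1 + (1 - s) * η / s * g2)
    (hQ0 : 0 ≤ Q) (hQ : Q ≤ (1 - s) / (1 + s) * (P + η * g1)) :
    s ^ 2 / η * Q ^ 2 + 2 * η * LS * N * g1 ≤ (1 - B) * η * (1 - η * L) * g1 ^ 2
      + (1 - s ^ 2) * (s / η) * P ^ 2 + B * η * (1 - s) * (1 - η * L) * g2 ^ 2 := by
  have hCpos : 0 < C := by rw [hC]; positivity
  have hc6 : c ≤ 1 / 6 := by nlinarith
  have hs6 : s ≤ 1 / 6 := hsc.trans hc6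
  have hτ0 : 0 ≤ (1 - s) / (1 + s) := div_nonneg (by linarith) (by linarith)
  have hτ1 : (1 - s) / (1 + s) ≤ 1 := by rw [div_le_one (by linarith)]; linarith
  have h1C : 0 < 1 - C := by linarith
  have hBpos : 0 < B := by rw [hB]; positivity
  have hBC : B * (1 - C) = c := by rw [hB]; field_simp
  have hB1 : B < 1 := by rw [hB, div_lt_one h1C]; nlinarith
  -- Q term
  have hQ' : Q ≤ P + η * g1 := hQ.trans (by
    have : 0 ≤ P + η * g1 := by positivity
    nlinarith)
  have hQ2 : Q ^ 2 ≤ 2 * (P ^ 2 + (η * g1) ^ 2) := by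
    have : Q ^ 2 ≤ (P + η * g1) ^ 2 := by gcongr
    nlinarith [sq_nonneg (P - η * g1)]
  -- N term
  have hN1 : N ≤ P + 2 * η / (s * (1 + s)) * g1 + (1 - s) * η / s * g2 := by nlinarith
  have hN2 : 2 * η * LS * N * g1 ≤
      2 * c * s * P * g1 + 4 * c * η / (1 + s) * g1 ^ 2 + 2 * c * (1 - s) * η * g1 * g2 := by
    have hR : 0 ≤ P + 2 * η / (s * (1 + s)) * g1 + (1 - s) * η / s * g2 := by
      have : 0 ≤ 1 - s := by linarith
      positivity
    calc 2 * η * LS * N * g1 = 2 * (η * LS) * N * g1 := by ring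
      _ ≤ 2 * (η * LS) * (P + 2 * η / (s * (1 + s)) * g1 + (1 - s) * η / s * g2) * g1 := by gcongr
      _ ≤ 2 * (c * s) * (P + 2 * η / (s * (1 + s)) * g1 + (1 - s) * η / s * g2) * g1 := by gcongr
      _ = _ := by field_simp; ring
  have hfrac : 4 * c * η / (1 + s) ≤ 4 * c * η * (1 - s + s ^ 2) := by
    rw [div_le_iff₀ (by linarith)]
    have : 0 ≤ 4 * c * η * s ^ 3 := by positivity
    nlinarith
  have hfr2 : 4 * c * η / (1 + s) * g1 ^ 2 ≤ 4 * c * η * (1 - s + s ^ 2) * g1 ^ 2 := by gcongr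
  -- lower bounds
  have hb1 : η * (c * (C + 5)) * g1 ^ 2 ≤ (1 - B) * η * (1 - η * L) * g1 ^ 2 := by
    have e : c * (C + 5) = (1 - B) * (1 - C) := by linarith
    have : (1 - B) * (1 - C) ≤ (1 - B) * (1 - η * L) := by
      apply mul_le_mul_of_nonneg_left <;> linarith
    calc η * (c * (C + 5)) * g1 ^ 2 ≤ η * ((1 - B) * (1 - η * L)) * g1 ^ 2 := by rw [e]; gcongr
      _ = _ := by ring
  have hb2 : c * η * (1 - s) * g2 ^ 2 ≤ B * η * (1 - s) * (1 - η * L) * g2 ^ 2 := by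
    have h0 : 0 ≤ 1 - s := by linarith
    have : B * (1 - C) ≤ B * (1 - η * L) := by
      apply mul_le_mul_of_nonneg_left <;> linarith
    calc c * η * (1 - s) * g2 ^ 2 ≤ (B * (1 - η * L)) * η * (1 - s) * g2 ^ 2 := by
          rw [← hBC]; gcongr
      _ = _ := by ring
  have hgg : 2 * c * (1 - s) * η * g1 * g2 ≤ c * (1 - s) * η * (g1 ^ 2 + g2 ^ 2) := by
    have h0 : 0 ≤ c * (1 - s) * η := mul_nonneg (mul_nonneg hc.le (by linarith)) hη.le
    have := mul_nonneg h0 (sq_nonneg (g1 - g2))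
    linarith
  have hPg : 2 * c * s * P * g1 ≤ c * s * (P ^ 2 / η + η * g1 ^ 2) := by
    have : 2 * P * g1 ≤ P ^ 2 / η + η * g1 ^ 2 := by
      have e : P ^ 2 / η + η * g1 ^ 2 - 2 * P * g1 = (P - η * g1) ^ 2 / η := by field_simp; ring
      have : 0 ≤ (P - η * g1) ^ 2 / η := by positivity
      linarith
    calc 2 * c * s * P * g1 = c * s * (2 * P * g1) := by ring
      _ ≤ _ := by gcongr
  have hQf : s ^ 2 / η * Q ^ 2 ≤ 2 * s ^ 2 * (P ^ 2 / η) + 2 * s ^ 2 * η * g1 ^ 2 := by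
    calc s ^ 2 / η * Q ^ 2 ≤ s ^ 2 / η * (2 * (P ^ 2 + (η * g1) ^ 2)) := by gcongr
      _ = _ := by field_simp
  have eP : (1 - s ^ 2) * (s / η) * P ^ 2 = (1 - s ^ 2) * s * (P ^ 2 / η) := by ring
  have fP : (2 * s ^ 2 + c * s) * (P ^ 2 / η) ≤ (1 - s ^ 2) * s * (P ^ 2 / η) := by
    apply mul_le_mul_of_nonneg_right _ (by positivity)
    have h36 : s ^ 2 ≤ 1 / 36 := by nlinarith
    have := mul_le_mul_of_nonneg_left (by linarith : 2 * s + c ≤ 1 - s ^ 2) hs.le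
    linarith
  have fg : (2 * s ^ 2 + c * s + 4 * c * (1 - s + s ^ 2) + c * (1 - s)) * (η * g1 ^ 2)
      ≤ c * (C + 5) * (η * g1 ^ 2) := by
    apply mul_le_mul_of_nonneg_right _ (by positivity)
    have : s ^ 2 ≤ c * s := by nlinarith
    have : c * s ^ 2 ≤ c * s * (1 / 6) := by nlinarith [mul_pos hc hs]
    nlinarith [mul_pos hc hs, mul_pos hc hCpos]
  rw [eP]
  linarith
end helpers

set_option maxHeartbeats 2000000 in
/-- Theorem 4.1 / `thm:discretize` of the paper.
Under the NOD setup, the Lyapunov function contracts: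
`Ψ_{k+1} ≤ (1 − √(ημ)) Ψ_k` for all `k ≥ 2`. -/
theorem nod_lyapunov_contraction
    (d : ℕ) (hd : 1 ≤ d) (μ Lφ LS : ℝ) (hμ : 0 < μ) (hLφ : 0 < Lφ) (hLS : 0 < LS)
    (φ : EuclideanSpace ℝ (Fin d) → ℝ)
    (S : EuclideanSpace ℝ (Fin d) → EuclideanSpace ℝ (Fin d))
    (zstar : EuclideanSpace ℝ (Fin d))
    (hφdiff : Differentiable ℝ φ)
    (hφsc : ∀ u v : EuclideanSpace ℝ (Fin d),
      φ v ≥ φ u + ⟪gradient φ u, v - u⟫ + μ / 2 * ‖v - u‖ ^ 2)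
    (hφsmooth : ∀ u v : EuclideanSpace ℝ (Fin d),
      ‖gradient φ u - gradient φ v‖ ≤ Lφ * ‖u - v‖)
    (hSmono : ∀ u v : EuclideanSpace ℝ (Fin d), ⟪S u - S v, u - v⟫ ≥ 0)
    (hSlip : ∀ u v : EuclideanSpace ℝ (Fin d), ‖S u - S v‖ ≤ LS * ‖u - v‖)
    (hstar : gradient φ zstar + S zstar = 0)
    (C B η : ℝ)
    (hC0 : 0 < C) (hC1 : C < 1)
    (hCeq : 1 - C - Real.sqrt C * (C + 6) = 0)
    (hB : B = Real.sqrt C / (1 - C))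
    (hη : 0 < η) (hηle : η ≤ C * min (1 / Lφ) (μ / LS ^ 2))
    (z ztil zhat : ℕ → EuclideanSpace ℝ (Fin d))
    (hinit1 : ztil 0 = z 0) (hinit2 : zhat 0 = z 0)
    (hrec1 : ∀ k : ℕ, z (k + 1) = ztil k - η • (gradient φ (ztil k) + S (zhat k)))
    (hrec2 : ∀ k : ℕ, ztil (k + 1) = z (k + 1)
      + ((1 - Real.sqrt (η * μ)) / (1 + Real.sqrt (η * μ))) • (z (k + 1) - z k))
    (hrec3 : ∀ k : ℕ, zhat (k + 1) = ztil (k + 1)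
      + (1 / Real.sqrt (η * μ) - 1) • (ztil (k + 1) - ztil k))
    (Ψ : ℕ → ℝ)
    (hΨ : ∀ k : ℕ, 2 ≤ k → Ψ k =
      μ * ‖ztil k + (1 / Real.sqrt (η * μ)) • (ztil k - z k) - zstar‖ ^ 2
      + 2 * (φ (ztil (k - 1)) - φ zstar - ⟪gradient φ zstar, ztil (k - 1) - zstar⟫)
      - η * ‖gradient φ (ztil (k - 1)) + S (zhat (k - 1))‖ ^ 2
      + (1 - η * μ) * Real.sqrt (μ / η) * ‖ztil (k - 1) - z (k - 1)‖ ^ 2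
      + B * η * (1 - Real.sqrt (η * μ)) * (1 - η * Lφ)
        * ‖gradient φ (ztil (k - 2)) + S (zhat (k - 2))‖ ^ 2) :
    ∀ k : ℕ, 2 ≤ k → Ψ (k + 1) ≤ (1 - Real.sqrt (η * μ)) * Ψ k := by
  intro k hk
  obtain ⟨n, rfl⟩ : ∃ n, k = n + 2 := ⟨k - 2, by omega⟩
  rw [hΨ (n + 2 + 1) (by omega), hΨ (n + 2) (by omega)]
  simp only [show n + 2 + 1 - 1 = n + 2 by omega, show n + 2 + 1 - 2 = n + 1 by omega,
    show n + 2 - 1 = n + 1 by omega, show n + 2 - 2 = n by omega]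
  obtain ⟨s, hsdef⟩ : ∃ s, s = Real.sqrt (η * μ) := ⟨_, rfl⟩
  obtain ⟨c, hcdef⟩ : ∃ c, c = Real.sqrt C := ⟨_, rfl⟩
  have hs : 0 < s := by rw [hsdef]; positivity
  have hc : 0 < c := by rw [hcdef]; positivity
  have hs2 : s ^ 2 = η * μ := by rw [hsdef]; exact Real.sq_sqrt (by positivity)
  have hc2 : C = c ^ 2 := by rw [hcdef]; exact (Real.sq_sqrt hC0.le).symm
  have hμs : μ = s ^ 2 / η := by rw [hs2]; field_simp
  have hsq : Real.sqrt (μ / η) = s / η := by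
    rw [Real.sqrt_eq_iff_mul_self_eq_of_pos (by positivity), hμs]; field_simp
  rw [← hsdef] at hrec2 hrec3
  rw [← hcdef] at hCeq hB
  rw [← hsdef, hsq]
  -- parameters
  have hμL : μ ≤ Lφ := by
    have : Nonempty (Fin d) := ⟨⟨0, hd⟩⟩
    obtain ⟨u, hu⟩ := exists_ne (0 : EuclideanSpace ℝ (Fin d))
    have h1 := hφsc u 0
    have h2 := hφsc 0 u
    have h3 := real_inner_le_norm (gradient φ u - gradient φ 0) u
    have h4 := hφsmooth u 0
    have hn : 0 < ‖u‖ := norm_pos_iff.2 hu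
    simp only [zero_sub, sub_zero, inner_neg_right, norm_neg] at h1 h2 h4
    rw [inner_sub_left] at h3
    have h5 := mul_le_mul_of_nonneg_right h4 hn.le
    have h6 : μ * ‖u‖ ^ 2 ≤ Lφ * ‖u‖ ^ 2 := by linarith
    exact le_of_mul_le_mul_right h6 (by positivity)
  have hηL : η * Lφ ≤ C := by
    have : η ≤ C * (1 / Lφ) := hηle.trans (by gcongr; exact min_le_left _ _)
    rwa [mul_one_div, le_div_iff₀ hLφ] at this
  have hηS : η * LS ≤ c * s := by
    have : η ≤ C * (μ / LS ^ 2) := hηle.trans (by gcongr; exact min_le_right _ _)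
    rw [← mul_div_assoc, le_div_iff₀ (by positivity)] at this
    refine (pow_le_pow_iff_left₀ (by positivity) (by positivity) two_ne_zero).1 ?_
    rw [mul_pow, mul_pow, hs2, ← hc2]
    have := mul_le_mul_of_nonneg_left this hη.le
    linarith
  have hsc : s ≤ c := by
    refine (pow_le_pow_iff_left₀ hs.le hc.le two_ne_zero).1 ?_
    rw [hs2, ← hc2]
    have := mul_le_mul_of_nonneg_left hμL hη.le
    linarith
  have hc6 : c ≤ 1 / 6 := by nlinarith
  have h1s : 0 < 1 - s := by linarith
  have h1s' : (1 + s) ≠ 0 := by linarith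
  have hs0 : s ≠ 0 := hs.ne'
  -- vectors
  obtain ⟨y0, hy0⟩ : ∃ y, y = ztil n := ⟨_, rfl⟩
  obtain ⟨y1, hy1⟩ : ∃ y, y = ztil (n + 1) := ⟨_, rfl⟩
  obtain ⟨y2, hy2⟩ : ∃ y, y = ztil (n + 2) := ⟨_, rfl⟩
  obtain ⟨y3, hy3⟩ : ∃ y, y = ztil (n + 2 + 1) := ⟨_, rfl⟩
  obtain ⟨z1, hz1⟩ : ∃ y, y = z (n + 1) := ⟨_, rfl⟩
  obtain ⟨z2, hz2⟩ : ∃ y, y = z (n + 2) := ⟨_, rfl⟩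
  obtain ⟨z3, hz3⟩ : ∃ y, y = z (n + 2 + 1) := ⟨_, rfl⟩
  obtain ⟨q0, hq0⟩ : ∃ y, y = gradient φ (ztil n) + S (zhat n) := ⟨_, rfl⟩
  obtain ⟨q1, hq1⟩ : ∃ y, y = gradient φ (ztil (n + 1)) + S (zhat (n + 1)) := ⟨_, rfl⟩
  obtain ⟨q2, hq2⟩ : ∃ y, y = gradient φ (ztil (n + 2)) + S (zhat (n + 2)) := ⟨_, rfl⟩
  obtain ⟨h1, hh1⟩ : ∃ y, y = zhat (n + 1) := ⟨_, rfl⟩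
  obtain ⟨h2, hh2⟩ : ∃ y, y = zhat (n + 2) := ⟨_, rfl⟩
  have rz1 := hrec1 n
  have rz2 : z (n + 2) = _ := hrec1 (n + 1)
  have rz3 := hrec1 (n + 2)
  have ry2 : ztil (n + 2) = _ := hrec2 (n + 1)
  have ry3 := hrec2 (n + 2)
  have rh1 := hrec3 n
  have rh2 : zhat (n + 2) = _ := hrec3 (n + 1)
  rw [show n + 1 + 1 = n + 2 from rfl] at ry2 rh2
  rw [← hq0, ← hy0, ← hz1] at rz1
  rw [← hq1, ← hy1, ← hz2] at rz2
  rw [← hq2, ← hy2, ← hz3] at rz3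
  rw [← hy2, ← hz2, ← hz1] at ry2
  rw [← hy3, ← hz3, ← hz2] at ry3
  rw [← hh1, ← hy1, ← hy0] at rh1
  rw [← hh2, ← hy2, ← hy1] at rh2
  rw [← hq0, ← hq1, ← hq2, ← hy1, ← hy2, ← hy3, ← hz1, ← hz2, ← hz3]
  rw [← hy2, ← hh2] at hq2
  rw [← hy1, ← hh1] at hq1
  clear hy0 hy1 hy2 hy3 hz1 hz2 hz3 hq0 hh1 hh2 hrec1 hrec2 hrec3 hinit1 hinit2 hΨ
  -- vector relations
  have hp2 : y2 - z2 = ((1 - s) / (1 + s)) • ((y1 - z1) - η • q1) := by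
    rw [ry2, rz2]; module
  have hδ : (y2 - z2) - η • q1 = y2 - y1 := by rw [rz2]; module
  have hδ1 : y0 = y1 - (y1 - z1) + η • q0 := by rw [rz1]; module
  have hhat : h2 - h1 = -(((1 - s) / (1 + s)) • (y1 - z1)) - (2 * η / (s * (1 + s))) • q1
      + ((1 - s) * η / s) • q0 := by
    have e2 : y2 = y1 + ((1 - s) / (1 + s)) • ((y1 - z1) - η • q1) - η • q1 := by
      rw [← hp2, rz2]; module
    rw [rh2, rh1, e2, hδ1]
    match_scalars <;> field_simp <;> ring
  have hw3 : y3 + (1 / s) • (y3 - z3) - zstar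
      = (1 - s) • ((y2 - zstar) + (1 / s) • (y2 - z2)) + s • (y2 - zstar) - (η / s) • q2 := by
    rw [ry3, rz3]
    match_scalars <;> field_simp <;> ring
  have hw2 : y2 + (1 / s) • (y2 - z2) - zstar = (y2 - zstar) + (1 / s) • (y2 - z2) := by abel
  have hm : h2 - zstar = (y2 - zstar) + ((1 - s) / s) • (y2 - z2)
      - (η * (1 - s) / s) • q1 := by
    rw [rh2, rz2]
    match_scalars <;> field_simp <;> ring
  have hgs : gradient φ zstar = - S zstar := eq_neg_of_add_eq_zero_left hstar
  have hq2' : q2 = (gradient φ y2 - gradient φ zstar) + (S h2 - S zstar) := by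
    rw [hq2, hgs]; abel
  have hid := nod_ident μ η s hη hs hμs (y2 - zstar) (y2 - z2) q1
    (gradient φ y2 - gradient φ zstar) (S h2 - S zstar)
  rw [← hq2', ← hw3, ← hw2, ← hm, hδ] at hid
  have hmono := hSmono h2 zstar
  have hsc1 := hφsc y2 zstar
  have hco := nod_cocoercive φ Lφ μ hLφ hμ hφdiff hφsc hφsmooth y2 y1
  have hQ : ‖y2 - z2‖ ≤ (1 - s) / (1 + s) * (‖y1 - z1‖ + η * ‖q1‖) := by
    rw [hp2, norm_smul, Real.norm_of_nonneg (by positivity)]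
    gcongr
    refine (norm_sub_le _ _).trans ?_
    rw [norm_smul, Real.norm_of_nonneg hη.le]
  have hN : ‖h2 - h1‖ ≤ (1 - s) / (1 + s) * ‖y1 - z1‖ + 2 * η / (s * (1 + s)) * ‖q1‖
      + (1 - s) * η / s * ‖q0‖ := by
    rw [hhat]
    refine (norm_add_le _ _).trans ?_
    refine (add_le_add_left (norm_sub_le _ _) _).trans ?_
    rw [norm_neg, norm_smul, norm_smul, norm_smul, Real.norm_of_nonneg (by positivity),
      Real.norm_of_nonneg (by positivity), Real.norm_of_nonneg (by positivity)]
  have hsca := nod_scalar c C B η Lφ s LS ‖y1 - z1‖ ‖q1‖ ‖q0‖ ‖h2 - h1‖ ‖y2 - z2‖ hc hc2 hC1 hCeq hB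
    hη hLφ hs hsc hηL hηS hLS (norm_nonneg _) (norm_nonneg _) (norm_nonneg _) hN (norm_nonneg _) hQ
  rw [← hμs] at hsca
  -- cross term
  have hcross : - 2 * η * ⟪q2, q1⟫ ≤ 1 / Lφ * ‖gradient φ y2 - gradient φ y1‖ ^ 2
      + η ^ 2 * Lφ * ‖q1‖ ^ 2 + 2 * η * LS * ‖h2 - h1‖ * ‖q1‖ - 2 * η * ‖q1‖ ^ 2 := by
    have e : q2 = q1 + (gradient φ y2 - gradient φ y1) + (S h2 - S h1) := by
      rw [hq2, hq1]; abel
    rw [e, inner_add_left, inner_add_left, real_inner_self_eq_norm_sq]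
    have a1 := neg_le_of_abs_le (abs_real_inner_le_norm (gradient φ y2 - gradient φ y1) q1)
    have a2 := neg_le_of_abs_le (abs_real_inner_le_norm (S h2 - S h1) q1)
    have a3 := mul_le_mul_of_nonneg_right (hSlip h2 h1) (norm_nonneg q1)
    have a4 : 2 * η * (‖gradient φ y2 - gradient φ y1‖ * ‖q1‖) ≤
        1 / Lφ * ‖gradient φ y2 - gradient φ y1‖ ^ 2 + η ^ 2 * Lφ * ‖q1‖ ^ 2 := by
      have e : 1 / Lφ * ‖gradient φ y2 - gradient φ y1‖ ^ 2 + η ^ 2 * Lφ * ‖q1‖ ^ 2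
        - 2 * η * (‖gradient φ y2 - gradient φ y1‖ * ‖q1‖)
        = 1 / Lφ * (‖gradient φ y2 - gradient φ y1‖ - η * Lφ * ‖q1‖) ^ 2 := by
        field_simp; ring
      have : 0 ≤ 1 / Lφ * (‖gradient φ y2 - gradient φ y1‖ - η * Lφ * ‖q1‖) ^ 2 := by positivity
      linarith
    have a5 := mul_le_mul_of_nonneg_left a1 (by positivity : 0 ≤ 2 * η)
    have a6 := mul_le_mul_of_nonneg_left (a2.trans' (neg_le_neg a3)) (by positivity : 0 ≤ 2 * η)
    linarith
  -- function values
  obtain ⟨F2, hF2⟩ : ∃ F, F = φ y2 - φ zstar - ⟪gradient φ zstar, y2 - zstar⟫ := ⟨_, rfl⟩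
  obtain ⟨F1, hF1⟩ : ∃ F, F = φ y1 - φ zstar - ⟪gradient φ zstar, y1 - zstar⟫ := ⟨_, rfl⟩
  rw [← hF1, ← hF2]
  have hA : F2 + μ / 2 * ‖y2 - zstar‖ ^ 2 ≤ ⟪gradient φ y2 - gradient φ zstar, y2 - zstar⟫ := by
    rw [hF2, inner_sub_left]
    rw [← neg_sub y2 zstar, inner_neg_right, norm_neg] at hsc1
    linarith
  have hBB : F2 - F1 + 1 / (2 * Lφ) * ‖gradient φ y2 - gradient φ y1‖ ^ 2
      ≤ ⟪gradient φ y2 - gradient φ zstar, y2 - y1⟫ := by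
    rw [hF2, hF1, inner_sub_left]
    rw [← neg_sub y2 y1, inner_neg_right] at hco
    have : y2 - y1 = (y2 - zstar) - (y1 - zstar) := by abel
    have e : ⟪gradient φ zstar, y2 - y1⟫
        = ⟪gradient φ zstar, y2 - zstar⟫ - ⟪gradient φ zstar, y1 - zstar⟫ := by
      rw [this, inner_sub_right]
    linarith
  have e2L : 2 * (1 / (2 * Lφ) * ‖gradient φ y2 - gradient φ y1‖ ^ 2)
      = 1 / Lφ * ‖gradient φ y2 - gradient φ y1‖ ^ 2 := by field_simp
  have hmono' := mul_nonneg hs.le hmono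
  have hA' := mul_le_mul_of_nonneg_left hA hs.le
  -- combine
  have hX : (1 - s) * (μ * ‖y2 - z2‖ ^ 2 - 2 * η * ⟪q2, q1⟫ + η * ‖q1‖ ^ 2
      + B * η * (1 - η * Lφ) * ‖q1‖ ^ 2
      + 2 * (F2 - F1 - ⟪gradient φ y2 - gradient φ zstar, y2 - y1⟫)) ≤
      (1 - s) * ((1 - s ^ 2) * (s / η) * ‖y1 - z1‖ ^ 2
        + B * η * (1 - s) * (1 - η * Lφ) * ‖q0‖ ^ 2) := by
    apply mul_le_mul_of_nonneg_left _ h1s.le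
    linarith
  have eμ : μ * (1 - s) / s * ‖y2 - z2‖ ^ 2
      = (1 - s ^ 2) * (s / η) * ‖y2 - z2‖ ^ 2 - (1 - s) * μ * ‖y2 - z2‖ ^ 2 := by
    rw [hμs]; field_simp; ring
  rw [← hs2]
  linarith
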